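/- arXiv:2603.21197 — 2 statements merged into one kernel-verified Lean document; each statement's English description precedes it below -/
import Mathlib

section
/- Let ρ be an anchored law with invertible covariance Σ := ∫ xxᵀ dρ(x), let θ ∈ Δ_d, set h_θ := Hᵀ(θ − 𝟙/d), and let X_1,…,X_n be i.i.d. with common law q_θ having density x ↦ 1 + h_θᵀx with respect to ρ. Define X̄ := (1/n)∑_m X_m and θ̂ := 𝟙/d + HΣ^{−1}X̄. Then E‖θ̂ − θ‖₂² = (1/n)∫ (1 + h_θᵀx) xᵀΣ^{−2}x dρ(x) − ‖h_θ‖₂²/n. If moreover ρ is exchangeable (invariant under all P_π := HᵀΠH), then E‖θ̂ − θ‖₂² = (1/n) tr Σ^{−1} − ‖h_θ‖₂²/n, and the supremum over θ ∈ Δ_d of this risk is attained at the uniform composition θ = 𝟙/d. -/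
open Finset MeasureTheory
open scoped ENNReal

theorem aux_HHt (d : ℕ) (hd : 2 ≤ d)
    (H : Matrix (Fin d) (Fin (d - 1)) ℝ)
    (horth : H.transpose * H = 1)
    (hcolsum : ∀ j, ∑ i, H i j = 0) (i k : Fin d) :
    ∑ j, H i j * H k j = (if i = k then 1 else 0) - 1 / (d : ℝ) := by
  have hd0 : (0 : ℝ) < d := by positivity
  have hs : (Real.sqrt d)⁻¹ * (Real.sqrt d)⁻¹ = 1 / (d : ℝ) := by
    rw [← mul_inv, Real.mul_self_sqrt hd0.le, one_div]
  let M : Matrix (Fin d) (Fin (d - 1) ⊕ Unit) ℝ :=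
    Matrix.of fun i s => Sum.elim (fun j => H i j) (fun _ => (Real.sqrt d)⁻¹) s
  have h1 : M.transpose * M = 1 := by
    ext s t
    rcases s with s | s <;> rcases t with t | t
    · have := congrFun (congrFun horth s) t
      simpa [M, Matrix.mul_apply, Matrix.one_apply] using this
    · simp [M, Matrix.mul_apply, ← Finset.sum_mul, hcolsum]
    · simp [M, Matrix.mul_apply, ← Finset.mul_sum, hcolsum]
    · simp only [M, Matrix.mul_apply, Matrix.transpose_apply, Matrix.of_apply, Sum.elim_inr, hs]
      simp; field_simp
  have h2 : M * M.transpose = 1 := by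
    refine (Matrix.mul_eq_one_comm_of_card_eq _ _ _ ?_).mp h1
    simp; omega
  have := congrFun (congrFun h2 i) k
  simp only [M, Matrix.mul_apply, Matrix.transpose_apply, Matrix.of_apply, Fintype.sum_sum_type,
    Sum.elim_inl, Sum.elim_inr, hs, Matrix.one_apply] at this
  simp at this ⊢
  linarith

theorem aux_int {k : ℕ} (μ : Measure (Fin k → ℝ)) [IsFiniteMeasure μ] (C : ℝ)
    (hC : ∀ᵐ x ∂μ, ∀ j, |x j| ≤ C) (g : (Fin k → ℝ) → ℝ) (hg : Continuous g) (p : ℝ≥0∞) :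
    MemLp g p μ := by
  have hK : IsCompact (Set.Icc (fun _ : Fin k => -C) (fun _ => C)) := isCompact_Icc
  obtain ⟨B, hB⟩ := hK.exists_bound_of_continuousOn hg.continuousOn
  refine MemLp.of_bound hg.aestronglyMeasurable B ?_
  filter_upwards [hC] with x hx
  exact hB x ⟨fun j => (abs_le.mp (hx j)).1, fun j => (abs_le.mp (hx j)).2⟩

theorem aux_iid {k n : ℕ} (hn : 1 ≤ n) (q : Measure (Fin k → ℝ)) [IsProbabilityMeasure q]
    (g : (Fin k → ℝ) → ℝ) (hg : MemLp g 2 q) (c : ℝ) (hc : ∫ x, g x ∂q = c) :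
    Integrable (fun ω : Fin n → Fin k → ℝ => ((n : ℝ)⁻¹ * ∑ m, g (ω m) - c) ^ 2)
      (Measure.pi fun _ : Fin n => q) ∧
    ∫ ω : Fin n → Fin k → ℝ, ((n : ℝ)⁻¹ * ∑ m, g (ω m) - c) ^ 2 ∂(Measure.pi fun _ : Fin n => q)
      = (1 / (n : ℝ)) * (∫ x, g x ^ 2 ∂q - c ^ 2) := by
  have hn0 : (n : ℝ) ≠ 0 := by positivity
  have hm : ∀ m : Fin n, MemLp (fun ω : Fin n → Fin k → ℝ => g (ω m)) 2
      (Measure.pi fun _ : Fin n => q) := fun m =>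
    hg.comp_measurePreserving (measurePreserving_eval (fun _ : Fin n => q) m)
  have hsum : MemLp (fun ω : Fin n → Fin k → ℝ => (n : ℝ)⁻¹ * ∑ m, g (ω m)) 2
      (Measure.pi fun _ : Fin n => q) :=
    (memLp_finsetSum _ (fun m _ => hm m)).const_mul _
  refine ⟨(hsum.sub (memLp_const c)).integrable_sq, ?_⟩
  have hmean : ∫ ω : Fin n → Fin k → ℝ, (n : ℝ)⁻¹ * ∑ m, g (ω m)
      ∂(Measure.pi fun _ : Fin n => q) = c := by
    rw [integral_const_mul, integral_finsetSum _ (fun m _ => (hm m).integrable (by norm_num))]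
    have : ∀ m : Fin n, ∫ ω : Fin n → Fin k → ℝ, g (ω m) ∂(Measure.pi fun _ : Fin n => q) = c := by
      intro m
      rw [← hc]
      exact integral_comp_eval (μ := fun _ : Fin n => q) (i := m) hg.aestronglyMeasurable
    simp [this]; field_simp
  have hv := ProbabilityTheory.variance_eq_integral hsum.aestronglyMeasurable.aemeasurable
  rw [hmean] at hv
  rw [← hv, ProbabilityTheory.variance_const_mul]
  have h3 := ProbabilityTheory.variance_sum_pi (μ := fun _ : Fin n => q) (X := fun _ => g)
    (fun _ => hg)
  have h4 : (∑ m : Fin n, fun ω : Fin n → Fin k → ℝ => g (ω m)) = fun ω => ∑ m, g (ω m) := by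
    ext ω; simp
  rw [h4] at h3
  rw [h3, ProbabilityTheory.variance_eq_sub hg, hc]
  simp
  field_simp

theorem aux_risk {k n : ℕ} (hn : 1 ≤ n) (q : Measure (Fin k → ℝ)) [IsProbabilityMeasure q]
    (C : ℝ) (hC : ∀ᵐ x ∂q, ∀ j, |x j| ≤ C) (A : Matrix (Fin k) (Fin k) ℝ) (h : Fin k → ℝ)
    (hA : ∀ j, ∫ x, A.mulVec x j ∂q = h j) :
    ∫ ω : Fin n → Fin k → ℝ, ∑ j, (A.mulVec ((n : ℝ)⁻¹ • ∑ m, ω m) j - h j) ^ 2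
      ∂(Measure.pi fun _ : Fin n => q)
      = (1 / (n : ℝ)) * ∫ x, ∑ j, (A.mulVec x j) ^ 2 ∂q - (∑ j, h j ^ 2) / n := by
  have hcont : ∀ j, Continuous fun x : Fin k → ℝ => A.mulVec x j := fun j => by
    unfold Matrix.mulVec dotProduct; fun_prop
  have e : ∀ (ω : Fin n → Fin k → ℝ) j, A.mulVec ((n : ℝ)⁻¹ • ∑ m, ω m) j
      = (n : ℝ)⁻¹ * ∑ m, A.mulVec (ω m) j := by
    intro ω j
    rw [Matrix.mulVec_smul, Matrix.mulVec_sum]; simp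
  simp_rw [e]
  have key := fun j => aux_iid hn q (fun x => A.mulVec x j)
    (aux_int q C hC _ (hcont j) 2) (h j) (hA j)
  rw [integral_finsetSum _ (fun j _ => (key j).1), Finset.sum_congr rfl (fun j _ => (key j).2),
    integral_finsetSum _ (fun j _ => (aux_int q C hC _ (hcont j) 2).integrable_sq)]
  rw [← Finset.mul_sum, Finset.sum_sub_distrib]
  ring

theorem aux_bdd (d : ℕ) (H : Matrix (Fin d) (Fin (d - 1)) ℝ)
    (horth : H.transpose * H = 1)
    (hcolsum : ∀ j, ∑ i, H i j = 0) :
    ∃ C : ℝ, ∀ x : Fin (d - 1) → ℝ, (∀ i, 0 ≤ 1 + ∑ j, H i j * x j) → ∀ j, |x j| ≤ C := by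
  refine ⟨∑ j, ∑ i, |H i j| * d, fun x hx j => ?_⟩
  have hsum : ∑ i, H.mulVec x i = 0 := by
    simp only [Matrix.mulVec, dotProduct]
    rw [Finset.sum_comm]
    simp [← Finset.sum_mul, hcolsum]
  have hx' : ∀ i, 0 ≤ 1 + H.mulVec x i := hx
  have hb : ∀ i, |H.mulVec x i| ≤ d := by
    intro i
    have h1 : 1 + H.mulVec x i ≤ ∑ i, (1 + H.mulVec x i) :=
      Finset.single_le_sum (fun i _ => hx' i) (Finset.mem_univ i)
    rw [Finset.sum_add_distrib, hsum] at h1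
    simp at h1
    have h2 := hx' i
    have h3 : (1 : ℝ) ≤ d := by
      have := i.pos
      exact_mod_cast this
    rw [abs_le]; constructor <;> linarith
  have e : x j = ∑ i, H i j * H.mulVec x i := by
    have : H.transpose.mulVec (H.mulVec x) = x := by
      rw [Matrix.mulVec_mulVec, horth, Matrix.one_mulVec]
    exact (congrFun this j).symm
  rw [e]
  calc |∑ i, H i j * H.mulVec x i| ≤ ∑ i, |H i j * H.mulVec x i| := Finset.abs_sum_le_sum_abs _ _
    _ ≤ ∑ i, |H i j| * d := by
      refine Finset.sum_le_sum fun i _ => ?_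
      rw [abs_mul]
      exact mul_le_mul_of_nonneg_left (hb i) (abs_nonneg _)
    _ ≤ _ := Finset.single_le_sum (f := fun j => ∑ i, |H i j| * (d : ℝ))
      (fun j _ => Finset.sum_nonneg fun i _ => by positivity) (Finset.mem_univ j)

theorem aux_isom (d : ℕ) (H : Matrix (Fin d) (Fin (d - 1)) ℝ)
    (horth : H.transpose * H = 1) (w : Fin (d - 1) → ℝ) :
    ∑ i, (H.mulVec w i) ^ 2 = ∑ j, w j ^ 2 := by
  have h1 : H.mulVec w ⬝ᵥ H.mulVec w = w ⬝ᵥ w := by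
    rw [Matrix.dotProduct_mulVec, Matrix.vecMul_mulVec, horth, Matrix.vecMul_one]
  simpa [dotProduct, sq] using h1

theorem aux_center (d : ℕ) (hd : 2 ≤ d)
    (H : Matrix (Fin d) (Fin (d - 1)) ℝ)
    (horth : H.transpose * H = 1)
    (hcolsum : ∀ j, ∑ i, H i j = 0) (θ : Fin d → ℝ) (hθ : ∑ i, θ i = 1) (i : Fin d) :
    H.mulVec (fun j => ∑ i, (θ i - 1 / (d : ℝ)) * H i j) i = θ i - 1 / (d : ℝ) := by
  have hd0 : (d : ℝ) ≠ 0 := by positivity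
  simp only [Matrix.mulVec, dotProduct, Finset.mul_sum]
  rw [Finset.sum_comm]
  have : ∀ k, ∑ j, H i j * ((θ k - 1 / (d : ℝ)) * H k j)
      = (θ k - 1 / (d : ℝ)) * ((if i = k then 1 else 0) - 1 / (d : ℝ)) := by
    intro k
    rw [← aux_HHt d hd H horth hcolsum i k, Finset.mul_sum]
    exact Finset.sum_congr rfl fun j _ => by ring
  simp_rw [this, mul_sub]
  rw [Finset.sum_sub_distrib, ← Finset.sum_mul, Finset.sum_sub_distrib, hθ]
  simp [hd0]

theorem aux_HP (d : ℕ) (hd : 2 ≤ d)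
    (H : Matrix (Fin d) (Fin (d - 1)) ℝ)
    (horth : H.transpose * H = 1)
    (hcolsum : ∀ j, ∑ i, H i j = 0) (π : Equiv.Perm (Fin d)) :
    H * (H.transpose * (Matrix.of fun i j : Fin d => if i = π j then (1 : ℝ) else 0) * H)
      = H.submatrix π.symm id := by
  have e : (Matrix.of fun i j : Fin d => if i = π j then (1 : ℝ) else 0) * H
      = H.submatrix π.symm id := by
    ext i j
    have : ∀ x, (i = π x) = (x = π.symm i) := fun x => by
      rw [Equiv.eq_symm_apply]; exact propext eq_comm
    simp [Matrix.mul_apply, this]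
  rw [Matrix.mul_assoc, e, ← Matrix.mul_assoc]
  ext i j
  have h0 : ∑ k, H (π.symm k) j = 0 := by
    rw [← hcolsum j]; exact Equiv.sum_comp π.symm (fun k => H k j)
  simp only [Matrix.mul_apply, Matrix.transpose_apply, aux_HHt d hd H horth hcolsum,
    Matrix.submatrix_apply, id, sub_mul, Finset.sum_sub_distrib, ← Finset.mul_sum, h0]
  simp

theorem aux_PtP (d : ℕ)
    (H : Matrix (Fin d) (Fin (d - 1)) ℝ)
    (horth : H.transpose * H = 1)
    (π : Equiv.Perm (Fin d))
    (P : Matrix (Fin (d - 1)) (Fin (d - 1)) ℝ) (hP : H * P = H.submatrix π.symm id) :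
    P.transpose * P = 1 := by
  have : P.transpose * P = (H * P).transpose * (H * P) := by
    rw [Matrix.transpose_mul, Matrix.mul_assoc, ← Matrix.mul_assoc H.transpose, horth,
      Matrix.one_mul]
  rw [this, hP, ← horth]
  ext i j
  simp only [Matrix.mul_apply, Matrix.transpose_apply, Matrix.submatrix_apply, id]
  exact Equiv.sum_comp π.symm (fun k => H k i * H k j)

theorem aux_exch (d : ℕ) (hd : 2 ≤ d)
    (H : Matrix (Fin d) (Fin (d - 1)) ℝ)
    (horth : H.transpose * H = 1)
    (hcolsum : ∀ j, ∑ i, H i j = 0)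
    (ρ : Measure (Fin (d - 1) → ℝ)) [IsProbabilityMeasure ρ]
    (C : ℝ) (hC : ∀ᵐ x ∂ρ, ∀ j, |x j| ≤ C)
    (Sig : Matrix (Fin (d - 1)) (Fin (d - 1)) ℝ)
    (hSig : Sig = Matrix.of fun j k => ∫ x, x j * x k ∂ρ) (hu : IsUnit Sig.det)
    (hex : ∀ π : Equiv.Perm (Fin d),
        ρ.map ((H.transpose * (Matrix.of fun i j : Fin d => if i = π j then (1 : ℝ) else 0) *
          H).mulVec) = ρ) (j : Fin (d - 1)) :
    ∫ x, x j * ∑ j, x j * ((Sig⁻¹ * Sig⁻¹).mulVec x) j ∂ρ = 0 := by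
  have hcm : ∀ (A : Matrix (Fin (d - 1)) (Fin (d - 1)) ℝ),
      Continuous fun x : Fin (d - 1) → ℝ => A.mulVec x := fun A => by
    unfold Matrix.mulVec dotProduct; fun_prop
  have hcm' : ∀ (A : Matrix (Fin (d - 1)) (Fin (d - 1)) ℝ) j,
      Continuous fun x : Fin (d - 1) → ℝ => A.mulVec x j := fun A j => by
    unfold Matrix.mulVec dotProduct; fun_prop
  have hint : ∀ g : (Fin (d - 1) → ℝ) → ℝ, Continuous g → Integrable g ρ := fun g hg =>
    memLp_one_iff_integrable.mp (aux_int ρ C hC g hg 1)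
  set M := Sig⁻¹ * Sig⁻¹ with hM
  let Q : (Fin (d - 1) → ℝ) → ℝ := fun x => ∑ j, x j * (M.mulVec x) j
  have hQ : Continuous Q := by
    have := hcm' M
    fun_prop
  let v : Fin (d - 1) → ℝ := fun j => ∫ x, x j * Q x ∂ρ
  have hv : ∀ π : Equiv.Perm (Fin d), ∀ i, H.mulVec v i = H.mulVec v (π.symm i) := by
    intro π
    have hmap := hex π
    set P := (H.transpose * (Matrix.of fun i j : Fin d => if i = π j then (1 : ℝ) else 0) * H)
      with hPdef
    have hHP := aux_HP d hd H horth hcolsum π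
    rw [← hPdef] at hHP
    clear_value P
    have hPP := aux_PtP d H horth π P hHP
    have hch : ∀ g : (Fin (d - 1) → ℝ) → ℝ, Continuous g →
        ∫ x, g (P.mulVec x) ∂ρ = ∫ x, g x ∂ρ := by
      intro g hg
      conv_rhs => rw [← hmap]
      rw [integral_map (hcm P).aemeasurable hg.aestronglyMeasurable]
    have hS : P * Sig * P.transpose = Sig := by
      ext a b
      have h1 := hch (fun x => x a * x b) (by fun_prop)
      have h2 : Sig a b = ∫ x, x a * x b ∂ρ := by rw [hSig]; rfl
      rw [h2, ← h1]
      simp only [Matrix.mulVec, dotProduct, Finset.sum_mul_sum]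
      rw [integral_finsetSum _ (fun _ _ => hint _ (by fun_prop))]
      simp only [Matrix.mul_apply, Matrix.transpose_apply, Finset.sum_mul]
      rw [Finset.sum_comm]
      refine Finset.sum_congr rfl fun s _ => ?_
      rw [integral_finsetSum _ (fun _ _ => hint _ (by fun_prop))]
      refine Finset.sum_congr rfl fun t _ => ?_
      have h3 : Sig s t = ∫ x, x s * x t ∂ρ := by rw [hSig]; rfl
      rw [h3, mul_right_comm, ← integral_const_mul]
      congr 1; ext x; ring
    have hSP : Sig * P = P * Sig := by
      conv_lhs => rw [← hS]
      rw [Matrix.mul_assoc, hPP, Matrix.mul_one]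
    have hAP : Sig⁻¹ * P = P * Sig⁻¹ := by
      calc Sig⁻¹ * P = Sig⁻¹ * (P * Sig) * Sig⁻¹ := by
            rw [Matrix.mul_assoc, Matrix.mul_assoc, Matrix.mul_nonsing_inv _ hu, Matrix.mul_one]
        _ = P * Sig⁻¹ := by
            rw [← hSP, ← Matrix.mul_assoc, Matrix.nonsing_inv_mul _ hu, Matrix.one_mul]
    have hMP : M * P = P * M := by
      rw [hM, Matrix.mul_assoc, hAP, ← Matrix.mul_assoc, hAP, Matrix.mul_assoc]
    have hQP : ∀ x, Q (P.mulVec x) = Q x := by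
      intro x
      change P.mulVec x ⬝ᵥ M.mulVec (P.mulVec x) = x ⬝ᵥ M.mulVec x
      rw [Matrix.mulVec_mulVec, hMP, ← Matrix.mulVec_mulVec, Matrix.dotProduct_mulVec,
        Matrix.vecMul_mulVec, hPP, Matrix.vecMul_one]
    have hPv : P.mulVec v = v := by
      ext j
      have h1 := hch (fun x => x j * Q x) (by fun_prop)
      simp only [hQP] at h1
      change _ = ∫ x, x j * Q x ∂ρ
      rw [← h1]
      simp only [Matrix.mulVec, dotProduct, Finset.sum_mul]
      rw [integral_finsetSum _ (fun _ _ => hint _ (by fun_prop))]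
      refine Finset.sum_congr rfl fun t _ => ?_
      rw [← integral_const_mul]
      congr 1; ext x; ring
    intro i
    conv_lhs => rw [← hPv, Matrix.mulVec_mulVec, hHP]
    rfl
  have hconst : ∀ i k, H.mulVec v i = H.mulVec v k := by
    intro i k
    have := hv (Equiv.swap i k) i
    simpa using this
  have hsum : ∑ i, H.mulVec v i = 0 := by
    simp only [Matrix.mulVec, dotProduct]
    rw [Finset.sum_comm]
    simp [← Finset.sum_mul, hcolsum]
  have hz : H.mulVec v = 0 := by
    ext i
    rw [Finset.sum_congr rfl (fun k _ => hconst k i)] at hsum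
    simp at hsum
    rcases hsum with h | h
    · omega
    · simpa using h
  have hv0 : v = 0 := by
    rw [← Matrix.one_mulVec v, ← horth, ← Matrix.mulVec_mulVec, hz, Matrix.mulVec_zero]
  exact congrFun hv0 j

theorem aux_main (d : ℕ) (hd : 2 ≤ d)
    (H : Matrix (Fin d) (Fin (d - 1)) ℝ)
    (horth : H.transpose * H = 1)
    (hcolsum : ∀ j, ∑ i, H i j = 0)
    (ρ : Measure (Fin (d - 1) → ℝ)) [IsProbabilityMeasure ρ]
    (hsupp : ∀ᵐ x ∂ρ, ∀ i, 0 ≤ 1 + ∑ j, H i j * x j)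
    (hmean : ∀ j, ∫ x, x j ∂ρ = 0)
    (C : ℝ) (hC : ∀ᵐ x ∂ρ, ∀ j, |x j| ≤ C)
    (n : ℕ) (hn : 1 ≤ n)
    (Sig : Matrix (Fin (d - 1)) (Fin (d - 1)) ℝ)
    (hSig : Sig = Matrix.of fun j k => ∫ x, x j * x k ∂ρ) (hu : IsUnit Sig.det)
    (θ : Fin d → ℝ) (h0 : ∀ i, 0 ≤ θ i) (h1 : ∑ i, θ i = 1)
    (h : Fin (d - 1) → ℝ) (hh : h = fun j => ∑ i, (θ i - 1 / (d : ℝ)) * H i j) :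
    ∫ ω : Fin n → Fin (d - 1) → ℝ, ∑ i, (((fun _ => 1 / (d : ℝ)) +
        H.mulVec (Sig⁻¹.mulVec ((n : ℝ)⁻¹ • ∑ m, ω m)) : Fin d → ℝ) i - θ i) ^ 2
        ∂(Measure.pi fun _ : Fin n =>
            ρ.withDensity fun x => ENNReal.ofReal (1 + ∑ j, h j * x j))
    = (1 / (n : ℝ)) *
            ∫ x, (1 + ∑ j, h j * x j) * ∑ j, x j * ((Sig⁻¹ * Sig⁻¹).mulVec x) j ∂ρ -
          (∑ j, (h j) ^ 2) / n := by
  have hint : ∀ g : (Fin (d - 1) → ℝ) → ℝ, Continuous g → Integrable g ρ := fun g hg =>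
    memLp_one_iff_integrable.mp (aux_int ρ C hC g hg 1)
  have hcm' : ∀ (A : Matrix (Fin (d - 1)) (Fin (d - 1)) ℝ) j,
      Continuous fun x : Fin (d - 1) → ℝ => A.mulVec x j := fun A j => by
    unfold Matrix.mulVec dotProduct; fun_prop
  have hpos : ∀ᵐ x ∂ρ, 0 ≤ 1 + ∑ j, h j * x j := by
    filter_upwards [hsupp] with x hx
    have e : 1 + ∑ j, h j * x j = ∑ i, θ i * (1 + ∑ j, H i j * x j) := by
      simp only [mul_add, mul_one, Finset.sum_add_distrib, h1, Finset.mul_sum]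
      rw [Finset.sum_comm]
      congr 1
      refine Finset.sum_congr rfl fun j _ => ?_
      rw [hh]
      simp only [sub_mul, Finset.sum_sub_distrib, ← Finset.mul_sum, hcolsum, Finset.sum_mul]
      simp [mul_assoc, Finset.sum_mul]
    rw [e]
    exact Finset.sum_nonneg fun i _ => mul_nonneg (h0 i) (hx i)
  have hmeas : Measurable fun x : Fin (d - 1) → ℝ => ENNReal.ofReal (1 + ∑ j, h j * x j) := by
    fun_prop
  have hq : ∀ g : (Fin (d - 1) → ℝ) → ℝ,
      ∫ x, g x ∂(ρ.withDensity fun x => ENNReal.ofReal (1 + ∑ j, h j * x j))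
      = ∫ x, (1 + ∑ j, h j * x j) * g x ∂ρ := by
    intro g
    rw [integral_withDensity_eq_integral_toReal_smul hmeas (by simp)]
    refine integral_congr_ae ?_
    filter_upwards [hpos] with x hx
    simp [ENNReal.toReal_ofReal hx]
  have hlin : ∫ x, (1 + ∑ j, h j * x j) ∂ρ = 1 := by
    rw [integral_add (by fun_prop) (hint _ (by fun_prop)),
      integral_finsetSum _ (fun _ _ => hint _ (by fun_prop))]
    simp [integral_const_mul, hmean]
  have hqp : IsProbabilityMeasure
      (ρ.withDensity fun x => ENNReal.ofReal (1 + ∑ j, h j * x j)) := by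
    constructor
    rw [withDensity_apply _ MeasurableSet.univ, Measure.restrict_univ,
      ← ofReal_integral_eq_lintegral_ofReal (hint _ (by fun_prop)) hpos, hlin, ENNReal.ofReal_one]
  have hqC : ∀ᵐ x ∂(ρ.withDensity fun x => ENNReal.ofReal (1 + ∑ j, h j * x j)),
      ∀ j, |x j| ≤ C := (withDensity_absolutelyContinuous _ _).ae_le hC
  have hA : ∀ j, ∫ x, Sig⁻¹.mulVec x j
      ∂(ρ.withDensity fun x => ENNReal.ofReal (1 + ∑ j, h j * x j)) = h j := by
    have hx : ∀ j, ∫ x, (1 + ∑ j, h j * x j) * x j ∂ρ = Sig.mulVec h j := by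
      intro j
      simp only [add_mul, one_mul, Finset.sum_mul]
      rw [integral_add (hint _ (by fun_prop)) (hint _ (by fun_prop)), hmean, zero_add,
        integral_finsetSum _ (fun _ _ => hint _ (by fun_prop))]
      simp only [Matrix.mulVec, dotProduct]
      refine Finset.sum_congr rfl fun t _ => ?_
      have h3 : Sig j t = ∫ x, x j * x t ∂ρ := by rw [hSig]; rfl
      rw [h3, ← integral_mul_const]
      congr 1; ext x; ring
    intro j
    rw [hq]
    have h4 : Sig⁻¹.mulVec (Sig.mulVec h) j = h j := by
      rw [Matrix.mulVec_mulVec, Matrix.nonsing_inv_mul _ hu, Matrix.one_mulVec]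
    rw [← h4]
    conv_rhs => rw [Matrix.mulVec, dotProduct]
    conv_lhs => simp only [Matrix.mulVec, dotProduct, Finset.mul_sum]
    rw [integral_finsetSum _ (fun _ _ => hint _ (by fun_prop))]
    refine Finset.sum_congr rfl fun t _ => ?_
    rw [← hx, ← integral_const_mul]
    congr 1; ext x; ring
  have hloss : ∀ ω : Fin n → Fin (d - 1) → ℝ, ∑ i, (((fun _ => 1 / (d : ℝ)) +
        H.mulVec (Sig⁻¹.mulVec ((n : ℝ)⁻¹ • ∑ m, ω m)) : Fin d → ℝ) i - θ i) ^ 2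
      = ∑ j, (Sig⁻¹.mulVec ((n : ℝ)⁻¹ • ∑ m, ω m) j - h j) ^ 2 := by
    intro ω
    have := aux_isom d H horth (Sig⁻¹.mulVec ((n : ℝ)⁻¹ • ∑ m, ω m) - h)
    simp only [Pi.sub_apply] at this
    rw [← this]
    refine Finset.sum_congr rfl fun i _ => ?_
    have hc := aux_center d hd H horth hcolsum θ h1 i
    rw [← hh] at hc
    rw [Matrix.mulVec_sub, Pi.sub_apply, hc, Pi.add_apply]
    ring
  simp_rw [hloss]
  rw [aux_risk hn _ C hqC _ h hA, hq]
  congr 3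
  ext x
  congr 1
  have hsym : Sig⁻¹.transpose = Sig⁻¹ := by
    rw [Matrix.transpose_nonsing_inv]
    congr 1
    rw [hSig]; ext a b
    simp [mul_comm]
  have : Sig⁻¹.mulVec x ⬝ᵥ Sig⁻¹.mulVec x = x ⬝ᵥ (Sig⁻¹ * Sig⁻¹).mulVec x := by
    rw [Matrix.dotProduct_mulVec, Matrix.vecMul_mulVec, hsym, Matrix.dotProduct_mulVec]
  simpa [dotProduct, sq] using this

theorem aux_trace (d : ℕ)
    (ρ : Measure (Fin (d - 1) → ℝ)) [IsProbabilityMeasure ρ]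
    (C : ℝ) (hC : ∀ᵐ x ∂ρ, ∀ j, |x j| ≤ C)
    (Sig : Matrix (Fin (d - 1)) (Fin (d - 1)) ℝ)
    (hSig : Sig = Matrix.of fun j k => ∫ x, x j * x k ∂ρ) (hu : IsUnit Sig.det)
    (h : Fin (d - 1) → ℝ)
    (hz : ∀ j, ∫ x, x j * ∑ j, x j * ((Sig⁻¹ * Sig⁻¹).mulVec x) j ∂ρ = 0) :
    ∫ x, (1 + ∑ j, h j * x j) * ∑ j, x j * ((Sig⁻¹ * Sig⁻¹).mulVec x) j ∂ρ = Sig⁻¹.trace := by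
  have hint : ∀ g : (Fin (d - 1) → ℝ) → ℝ, Continuous g → Integrable g ρ := fun g hg =>
    memLp_one_iff_integrable.mp (aux_int ρ C hC g hg 1)
  set M := Sig⁻¹ * Sig⁻¹ with hM
  have hcm' : ∀ j, Continuous fun x : Fin (d - 1) → ℝ => M.mulVec x j := fun j => by
    unfold Matrix.mulVec dotProduct; fun_prop
  have hQ : Continuous fun x : Fin (d - 1) → ℝ => ∑ j, x j * (M.mulVec x) j := by fun_prop
  simp only [add_mul, one_mul]
  rw [integral_add (hint _ hQ) (hint _ (by fun_prop))]
  have h2 : ∫ x, (∑ j, h j * x j) * ∑ j, x j * (M.mulVec x) j ∂ρ = 0 := by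
    simp only [Finset.sum_mul (s := univ) (f := fun j => h j * _), mul_assoc]
    rw [integral_finsetSum _ (fun _ _ => hint _ (by fun_prop))]
    simp only [integral_const_mul, hz, mul_zero, Finset.sum_const_zero]
  rw [h2, add_zero]
  have h3 : Sig⁻¹ = M * Sig := by
    rw [hM, Matrix.mul_assoc, Matrix.nonsing_inv_mul _ hu, Matrix.mul_one]
  rw [h3, Matrix.trace]
  rw [integral_finsetSum _ (fun _ _ => hint _ (by fun_prop))]
  refine Finset.sum_congr rfl fun j _ => ?_
  simp only [Matrix.diag, Matrix.mul_apply, Matrix.mulVec, dotProduct, Finset.mul_sum]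
  rw [integral_finsetSum _ (fun _ _ => hint _ (by fun_prop))]
  refine Finset.sum_congr rfl fun k _ => ?_
  have h3 : Sig k j = ∫ x, x k * x j ∂ρ := by rw [hSig]; rfl
  rw [h3, ← integral_const_mul]
  congr 1; ext x; ring


/-- **exact i.i.d. risk.** Let `ρ` be an anchored law with invertible
covariance `Σ`, let `θ ∈ Δ_d`, `h_θ := Hᵀ(θ - 𝟙/d)`, and let `X₁,…,Xₙ` be i.i.d. with
density `1 + h_θᵀx` with respect to `ρ`.  With `θ̂ = 𝟙/d + HΣ⁻¹X̄`, the risk is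
`E‖θ̂ - θ‖² = (1/n) ∫ (1 + h_θᵀx) xᵀΣ⁻²x dρ - ‖h_θ‖²/n`.  If moreover `ρ` is
exchangeable, the risk equals `(1/n) tr Σ⁻¹ - ‖h_θ‖²/n` and its supremum over
`θ ∈ Δ_d` is attained at the uniform composition. -/
theorem stmt13 (d : ℕ) (hd : 2 ≤ d)
    (H : Matrix (Fin d) (Fin (d - 1)) ℝ)
    (horth : H.transpose * H = 1)
    (hcolsum : ∀ j, ∑ i, H i j = 0)
    (ρ : Measure (Fin (d - 1) → ℝ)) [IsProbabilityMeasure ρ]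
    (hsupp : ρ {x | ∀ i, 0 ≤ 1 + ∑ j, H i j * x j}ᶜ = 0)
    (hmean : ∫ x, x ∂ρ = 0)
    (n : ℕ) (hn : 1 ≤ n) :
    let Sig : Matrix (Fin (d - 1)) (Fin (d - 1)) ℝ :=
      Matrix.of fun j k => ∫ x, x j * x k ∂ρ
    let hvec : (Fin d → ℝ) → Fin (d - 1) → ℝ :=
      fun θ j => ∑ i, (θ i - 1 / (d : ℝ)) * H i j
    let est : (Fin n → Fin (d - 1) → ℝ) → Fin d → ℝ :=
      fun ω => (fun _ => 1 / (d : ℝ)) + H.mulVec (Sig⁻¹.mulVec ((n : ℝ)⁻¹ • ∑ m, ω m))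
    let Risk : (Fin d → ℝ) → ℝ := fun θ =>
      ∫ ω, ∑ i, (est ω i - θ i) ^ 2
        ∂(Measure.pi fun _ : Fin n =>
            ρ.withDensity fun x => ENNReal.ofReal (1 + ∑ j, hvec θ j * x j))
    ∀ _ : IsUnit Sig.det,
    (∀ θ : Fin d → ℝ, (∀ i, 0 ≤ θ i) → ∑ i, θ i = 1 →
      Risk θ =
        (1 / (n : ℝ)) *
            ∫ x, (1 + ∑ j, hvec θ j * x j) * ∑ j, x j * ((Sig⁻¹ * Sig⁻¹).mulVec x) j ∂ρ -
          (∑ j, (hvec θ j) ^ 2) / n) ∧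
    ((∀ π : Equiv.Perm (Fin d),
        ρ.map ((H.transpose * (Matrix.of fun i j : Fin d => if i = π j then (1 : ℝ) else 0) *
          H).mulVec) = ρ) →
      (∀ θ : Fin d → ℝ, (∀ i, 0 ≤ θ i) → ∑ i, θ i = 1 →
        Risk θ = (1 / (n : ℝ)) * Sig⁻¹.trace - (∑ j, (hvec θ j) ^ 2) / n) ∧
      (∀ θ : Fin d → ℝ, (∀ i, 0 ≤ θ i) → ∑ i, θ i = 1 →
        Risk θ ≤ Risk fun _ => 1 / (d : ℝ))) := by

  intro Sig hvec est Risk hu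
  have hs : ∀ᵐ x ∂ρ, ∀ i, 0 ≤ 1 + ∑ j, H i j * x j := hsupp
  obtain ⟨C, hC0⟩ := aux_bdd d H horth hcolsum
  have hC : ∀ᵐ x ∂ρ, ∀ j, |x j| ≤ C := by
    filter_upwards [hs] with x hx using hC0 x hx
  have hm : ∀ j, ∫ x, x j ∂ρ = 0 := by
    intro j
    have := eval_integral (μ := ρ) (f := fun x : Fin (d - 1) → ℝ => x)
      (fun i => memLp_one_iff_integrable.mp
        (aux_int ρ C hC (fun x => x i) (by fun_prop) 1)) j
    rw [hmean] at this
    exact this.symm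
  have main := fun θ h0 h1 => aux_main d hd H horth hcolsum ρ hs hm C hC n hn Sig rfl hu θ h0 h1
    (hvec θ) rfl
  refine ⟨main, fun hex => ?_⟩
  have hz := aux_exch d hd H horth hcolsum ρ C hC Sig rfl hu hex
  have second : ∀ θ : Fin d → ℝ, (∀ i, 0 ≤ θ i) → ∑ i, θ i = 1 →
        Risk θ = (1 / (n : ℝ)) * Sig⁻¹.trace - (∑ j, (hvec θ j) ^ 2) / n := by
    intro θ h0 h1
    refine (main θ h0 h1).trans ?_
    rw [aux_trace d ρ C hC Sig rfl hu (hvec θ) hz]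
  refine ⟨second, fun θ h0 h1 => ?_⟩
  have hd0 : (d : ℝ) ≠ 0 := by positivity
  rw [second θ h0 h1, second (fun _ => 1 / (d : ℝ)) (fun _ => by positivity) (by simp [hd0])]
  have e : ∑ j, hvec (fun _ => 1 / (d : ℝ)) j ^ 2 = 0 := by simp [hvec]
  rw [e]
  have : 0 ≤ (∑ j, hvec θ j ^ 2) / (n : ℝ) := by positivity
  simp
  linarith
end

section
/- Let d ≥ 3. Every anchored law ρ satisfies the trace cap tr Σ(ρ) ≤ (d(d−1)/(d + 2√(d−1))) · χ_*(ρ), where Σ(ρ) := ∫ xxᵀ dρ(x) and χ_*(ρ) := max_{i≠j} ∫ ((γ_j − γ_i)ᵀx)²/(1 + γ_iᵀx) dρ(x) ∈ [0,∞] (with the convention that the integrand is 0 where both numerator and denominator vanish and +∞ where only the denominator vanishes). Moreover, setting λ_* := √(d−1), t_λ := d(λ−1)/(d+λ−1), C_*(d) := (λ_*−1)²(λ_*+1)/(λ_*(d+λ_*−1)), for every 0 ≤ C ≤ C_*(d) the augmented randomized response law ρ_{p,λ_*} := (1−p)δ_0 + (p/d)∑_{i=1}^d δ_{t_{λ_*}γ_i}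 with p := C/C_*(d) is an anchored law satisfying χ_*(ρ_{p,λ_*}) = C and tr Σ(ρ_{p,λ_*}) = (d(d−1)/(d + 2√(d−1))) · C, so the cap is attained. -/
open Finset MeasureTheory
open scoped ENNReal

/-- scalar core -/
lemma aux_scalar (L n m b D d Q S : ℝ) (hL : 0 < L) (hn : n = L ^ 2) (hd : d = n + 1)
    (hb : 0 < b) (hbm : b ≤ m) (hsum : m + n * b = d) (hD : 0 ≤ D)
    (hS : S = m ^ 2 + n * b ^ 2 + D) (hQ : 1 / m + n / b + D / (m * b ^ 2) ≤ Q) :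
    (S - d) * (d + 2 * L) ≤ S * Q - d ^ 2 := by
  have hm : 0 < m := lt_of_lt_of_le hb hbm
  have hn0 : 0 < n := by rw [hn]; positivity
  have hd0 : 0 < d := by rw [hd]; positivity
  have hS0 : 0 ≤ S := by rw [hS]; positivity
  suffices h : (S - d) * (d + 2 * L) ≤ S * (1 / m + n / b + D / (m * b ^ 2)) - d ^ 2 by
    have := mul_le_mul_of_nonneg_left hQ hS0
    linarith
  -- zeroth-order term
  have h0 : 0 ≤ (m ^ 2 + n * b ^ 2) * (1 / m + n / b - d - 2 * L) + 2 * L * d := by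
    have key : d * ((m ^ 2 + n * b ^ 2) * (1 / m + n / b - d - 2 * L) + 2 * L * d)
        = n * (m - b) ^ 2 * (m - L * b) ^ 2 / (m * b) := by
      have e1 : d * ((m ^ 2 + n * b ^ 2) * (1 / m + n / b - d - 2 * L) + 2 * L * d)
        = (m ^ 2 + n * b ^ 2) * ((m + n * b) * (1 / m + n / b) - (n + 1) ^ 2 - 2 * L * (n + 1))
          + 2 * L * (m + n * b) ^ 2 := by
        rw [hsum, hd]; ring
      rw [e1, hn]; field_simp; ring
    have : 0 ≤ d * ((m ^ 2 + n * b ^ 2) * (1 / m + n / b - d - 2 * L) + 2 * L * d) := by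
      rw [key]; positivity
    exact nonneg_of_mul_nonneg_right this hd0
  have h1 : 0 ≤ (m ^ 2 + n * b ^ 2) / (m * b ^ 2) + (1 / m + n / b - d - 2 * L) := by
    have key : d * ((m ^ 2 + n * b ^ 2) / (m * b ^ 2) + (1 / m + n / b - d - 2 * L))
        = ((m - b) * (m + n * b) * m + (n + 1) * b * (m - L * b) ^ 2) / (m * b ^ 2) := by
      have e1 : d * ((m ^ 2 + n * b ^ 2) / (m * b ^ 2) + (1 / m + n / b - d - 2 * L))
        = (m + n * b) * ((m ^ 2 + n * b ^ 2) / (m * b ^ 2) + (1 / m + n / b))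
          - (n + 1) ^ 2 - 2 * L * (n + 1) := by
        rw [hsum, hd]; ring
      rw [e1, hn]; field_simp; ring
    have : 0 ≤ d * ((m ^ 2 + n * b ^ 2) / (m * b ^ 2) + (1 / m + n / b - d - 2 * L)) := by
      rw [key]
      have : 0 ≤ m - b := by linarith
      positivity
    exact nonneg_of_mul_nonneg_right this hd0
  have h2 : 0 ≤ D ^ 2 / (m * b ^ 2) := by positivity
  have h3 := mul_nonneg hD h1
  have : S * (1 / m + n / b + D / (m * b ^ 2)) - d ^ 2 - (S - d) * (d + 2 * L)
     = ((m ^ 2 + n * b ^ 2) * (1 / m + n / b - d - 2 * L) + 2 * L * d)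
      + D * ((m ^ 2 + n * b ^ 2) / (m * b ^ 2) + (1 / m + n / b - d - 2 * L))
      + D ^ 2 / (m * b ^ 2) := by
    rw [hS]; ring
  linarith

lemma aux_vec (d : ℕ) (hd : 3 ≤ d) (v : Fin d → ℝ) (hv : ∀ i, 0 < v i) (hs : ∑ i, v i = d) :
    (∑ i, v i ^ 2 - d) * (d + 2 * Real.sqrt ((d : ℝ) - 1)) ≤
      (∑ i, v i ^ 2) * (∑ i, 1 / v i) - (d : ℝ) ^ 2 := by
  have hd3 : (3 : ℝ) ≤ d := by exact_mod_cast hd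
  have : Nonempty (Fin d) := ⟨⟨0, by omega⟩⟩
  obtain ⟨i0, hi0⟩ := Finite.exists_max v
  set m := v i0 with hm
  set n : ℝ := (d : ℝ) - 1 with hn
  have hn0 : 0 < n := by linarith
  set s := (univ : Finset (Fin d)).erase i0 with hsdef
  have split : ∀ f : Fin d → ℝ, ∑ i, f i = f i0 + ∑ i ∈ s, f i := fun f =>
    (Finset.add_sum_erase univ f (mem_univ i0)).symm
  have hcard : (s.card : ℝ) = n := by
    rw [hsdef, card_erase_of_mem (mem_univ _), card_univ, Fintype.card_fin,
      Nat.cast_sub (by omega)]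
    simp [hn]
  set σ := ∑ i ∈ s, v i with hσ
  set b := σ / n with hb
  have hσb : σ = n * b := by rw [hb]; field_simp
  have hsne : s.Nonempty := by
    rw [← card_pos]; have : (0 : ℝ) < s.card := by rw [hcard]; exact hn0
    exact_mod_cast this
  have hb0 : 0 < b := div_pos (sum_pos (fun i _ => hv i) hsne) hn0
  have hbm : b ≤ m := by
    rw [hb, div_le_iff₀ hn0]
    calc σ ≤ ∑ _i ∈ s, m := sum_le_sum (fun i _ => hi0 i)
      _ = m * n := by rw [sum_const, nsmul_eq_mul, hcard]; ring
  have hm0 : 0 < m := hv i0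
  have hsum : m + n * b = d := by rw [← hσb, ← hs, split v]
  have hDexp : ∑ i ∈ s, (v i - b) ^ 2 = ∑ i ∈ s, v i ^ 2 - n * b ^ 2 := by
    have : ∀ i ∈ s, (v i - b) ^ 2 = v i ^ 2 - 2 * b * v i + b ^ 2 := fun i _ => by ring
    rw [sum_congr rfl this, sum_add_distrib, sum_sub_distrib, ← mul_sum, sum_const,
      nsmul_eq_mul, hcard, ← hσ, hσb]; ring
  apply aux_scalar (Real.sqrt n) n m b (∑ i ∈ s, (v i - b) ^ 2) d _ _ (Real.sqrt_pos.2 hn0)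
    (Real.sq_sqrt hn0.le).symm (by rw [hn]; ring) hb0 hbm hsum (sum_nonneg fun i _ => sq_nonneg _)
  · rw [hDexp, split]; ring
  · rw [split fun i => 1 / v i]
    have hpt : ∀ i ∈ s, 1 / b - (v i - b) / b ^ 2 + (v i - b) ^ 2 / (m * b ^ 2) ≤ 1 / v i := by
      intro i _
      have e : 1 / v i = 1 / b - (v i - b) / b ^ 2 + (v i - b) ^ 2 / (v i * b ^ 2) := by
        have := (hv i).ne'
        field_simp; ring
      rw [e]
      have : (v i - b) ^ 2 / (m * b ^ 2) ≤ (v i - b) ^ 2 / (v i * b ^ 2) := by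
        have := hv i
        have := hi0 i
        gcongr
      linarith
    have := sum_le_sum hpt
    have e2 : ∑ i ∈ s, (1 / b - (v i - b) / b ^ 2 + (v i - b) ^ 2 / (m * b ^ 2))
        = n / b + (∑ i ∈ s, (v i - b) ^ 2) / (m * b ^ 2) := by
      have e3 : ∑ i ∈ s, (v i - b) / b ^ 2 = 0 := by
        rw [← sum_div, sum_sub_distrib, sum_const, nsmul_eq_mul, hcard, ← hσ, hσb]
        simp
      rw [sum_add_distrib, sum_sub_distrib, e3, sum_const, nsmul_eq_mul, hcard, sum_div]
      ring
    rw [e2] at this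
    linarith

lemma aux_pairs (d : ℕ) (hd : 3 ≤ d) (v : Fin d → ℝ) (hv : ∀ i, 0 < v i) (hs : ∑ i, v i = d) :
    (∑ i, (v i - 1) ^ 2) * (d + 2 * Real.sqrt ((d : ℝ) - 1)) ≤
      ∑ i, ∑ j, (v j - v i) ^ 2 / v i := by
  have h := aux_vec d hd v hv hs
  have e1 : ∑ i, (v i - 1) ^ 2 = ∑ i, v i ^ 2 - d := by
    have : ∀ i, (v i - 1) ^ 2 = v i ^ 2 - 2 * v i + 1 := fun i => by ring
    simp_rw [this]
    rw [sum_add_distrib, sum_sub_distrib, ← mul_sum, hs]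
    simp; ring
  have e2 : ∑ i, ∑ j, (v j - v i) ^ 2 / v i =
      (∑ i, v i ^ 2) * (∑ i, 1 / v i) - (d : ℝ) ^ 2 := by
    have : ∀ i, ∑ j, (v j - v i) ^ 2 / v i = (∑ j, v j ^ 2) * (1 / v i) - 2 * d + d * v i := by
      intro i
      have h1 : ∀ j, (v j - v i) ^ 2 / v i = v j ^ 2 * (1 / v i) - 2 * v j + v i := by
        intro j
        have := (hv i).ne'
        field_simp; ring
      simp_rw [h1]
      rw [sum_add_distrib, sum_sub_distrib, ← mul_sum, hs, ← sum_mul]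
      simp
    simp_rw [this]
    rw [sum_add_distrib, sum_sub_distrib, ← mul_sum, ← mul_sum univ v, hs] 
    simp; ring
  rw [e1, e2]; exact h

lemma aux_gram (d : ℕ) (hd : 3 ≤ d) (H : Matrix (Fin d) (Fin (d - 1)) ℝ)
    (horth : H.transpose * H = 1) (hcolsum : ∀ j, ∑ i, H i j = 0) (i k : Fin d) :
    ∑ l, H i l * H k l = (if i = k then 1 else 0) - 1 / (d : ℝ) := by
  have hd3 : (3 : ℝ) ≤ d := by exact_mod_cast hd
  let N : Matrix (Fin d) (Fin (d - 1) ⊕ Unit) ℝ :=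
    Matrix.of fun i s => Sum.elim (fun l => H i l) (fun _ => 1 / Real.sqrt d) s
  have hsq : (1 / Real.sqrt d) * (1 / Real.sqrt d) = 1 / (d : ℝ) := by
    rw [div_mul_div_comm, Real.mul_self_sqrt (by linarith), one_mul]
  have h1 : N.transpose * N = 1 := by
    ext a c
    rw [Matrix.mul_apply]
    rcases a with a | a <;> rcases c with c | c
    · have := congrFun (congrFun horth a) c
      rw [Matrix.mul_apply] at this
      simp only [Matrix.transpose_apply] at this
      simp [N, this, Matrix.one_apply]
    · simp [N, ← sum_mul, hcolsum]
    · simp [N, ← mul_sum, hcolsum]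
    · simp only [N, Matrix.transpose_apply, Matrix.of_apply, Sum.elim_inr, hsq]
      simp
      field_simp
  have h2 : N * N.transpose = 1 :=
    (Matrix.mul_eq_one_comm_of_card_eq _ _ _ (by simp; omega)).1 h1
  have := congrFun (congrFun h2 i) k
  rw [Matrix.mul_apply, Fintype.sum_sum_type] at this
  simp only [N, Matrix.transpose_apply, Matrix.of_apply, Sum.elim_inl, Sum.elim_inr, hsq,
    Matrix.one_apply] at this
  simp at this
  rw [← this]; simp

lemma aux_norm (d : ℕ) (H : Matrix (Fin d) (Fin (d - 1)) ℝ)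
    (horth : H.transpose * H = 1) (x : Fin (d - 1) → ℝ) :
    ∑ i, (∑ j, H i j * x j) ^ 2 = ∑ j, x j * x j := by
  have : H.mulVec x ⬝ᵥ H.mulVec x = x ⬝ᵥ x := by
    rw [Matrix.dotProduct_mulVec, ← Matrix.mulVec_transpose, Matrix.mulVec_mulVec, horth,
      Matrix.one_mulVec]
  simp only [dotProduct, Matrix.mulVec] at this
  rw [← this]
  exact sum_congr rfl fun i _ => by ring

lemma aux_ofReal_integral_le {α : Type*} [MeasurableSpace α] (μ : Measure α) (f : α → ℝ)
    (hf : ∀ x, 0 ≤ f x) : ENNReal.ofReal (∫ x, f x ∂μ) ≤ ∫⁻ x, ENNReal.ofReal (f x) ∂μ := by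
  by_cases h : Integrable f μ
  · rw [ofReal_integral_eq_lintegral_ofReal h (Filter.Eventually.of_forall hf)]
  · rw [integral_undef h]; simp

theorem stmt17 (d : ℕ) (hd : 3 ≤ d)
    (H : Matrix (Fin d) (Fin (d - 1)) ℝ)
    (horth : H.transpose * H = 1)
    (hcolsum : ∀ j, ∑ i, H i j = 0) :
    let 𝒳 : Set (Fin (d - 1) → ℝ) := {x | ∀ i, 0 ≤ 1 + ∑ j, H i j * x j}
    let chiInt : Fin d → Fin d → (Fin (d - 1) → ℝ) → ℝ≥0∞ := fun i j x =>
      if 1 + ∑ l, H i l * x l = 0 then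
        (if ∑ l, (H j l - H i l) * x l = 0 then 0 else ⊤)
      else ENNReal.ofReal ((∑ l, (H j l - H i l) * x l) ^ 2 / (1 + ∑ l, H i l * x l))
    let chi : Measure (Fin (d - 1) → ℝ) → ℝ≥0∞ := fun μ =>
      ⨆ (i) (j) (_ : i ≠ j), ∫⁻ x, chiInt i j x ∂μ
    let trSig : Measure (Fin (d - 1) → ℝ) → ℝ :=
      fun μ => (Matrix.of fun j k : Fin (d - 1) => ∫ x, x j * x k ∂μ).trace
    let lam : ℝ := Real.sqrt ((d : ℝ) - 1)
    let Kd : ℝ := (d : ℝ) * ((d : ℝ) - 1) / ((d : ℝ) + 2 * lam)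
    let Cstar : ℝ := (lam - 1) ^ 2 * (lam + 1) / (lam * ((d : ℝ) + lam - 1))
    let t : ℝ := (d : ℝ) * (lam - 1) / ((d : ℝ) + lam - 1)
    (∀ ρ : Measure (Fin (d - 1) → ℝ), IsProbabilityMeasure ρ → ρ 𝒳ᶜ = 0 →
      (∫ x, x ∂ρ) = 0 →
      ENNReal.ofReal (trSig ρ) ≤ ENNReal.ofReal Kd * chi ρ) ∧
    (∀ C : ℝ, 0 ≤ C → C ≤ Cstar →
      let p : ℝ := C / Cstar
      let ρp : Measure (Fin (d - 1) → ℝ) :=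
        ENNReal.ofReal (1 - p) • Measure.dirac 0 +
          ∑ i : Fin d, ENNReal.ofReal (p / d) • Measure.dirac (t • fun j => H i j)
      IsProbabilityMeasure ρp ∧ ρp 𝒳ᶜ = 0 ∧ (∫ x, x ∂ρp) = 0 ∧
        chi ρp = ENNReal.ofReal C ∧ trSig ρp = Kd * C) := by
  intro 𝒳 chiInt chi trSig lam Kd Cstar t
  have hd3 : (3 : ℝ) ≤ d := by exact_mod_cast hd
  have hlam2 : lam ^ 2 = d - 1 := Real.sq_sqrt (by linarith)
  have hlam1 : 1 < lam := by
    have : 0 ≤ lam := Real.sqrt_nonneg _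
    nlinarith
  have hdiff : ∀ (i j : Fin d) (x : Fin (d - 1) → ℝ), ∑ l, (H j l - H i l) * x l
      = (1 + ∑ l, H j l * x l) - (1 + ∑ l, H i l * x l) := by
    intro i j x
    simp only [sub_mul, sum_sub_distrib]; ring
  have hself : ∀ i x, chiInt i i x = 0 := by
    intro i x; simp [chiInt]
  refine ⟨?_, ?_⟩
  · intro ρ hρ hX _
    have hmeas : ∀ i j, Measurable (chiInt i j) := by
      intro i j
      have m1 : Measurable fun x : Fin (d - 1) → ℝ => 1 + ∑ l, H i l * x l := by fun_prop
      have m2 : Measurable fun x : Fin (d - 1) → ℝ => ∑ l, (H j l - H i l) * x l := by fun_prop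
      refine Measurable.ite (measurableSet_eq_fun m1 measurable_const) ?_ ?_
      · exact Measurable.ite (measurableSet_eq_fun m2 measurable_const) measurable_const
          measurable_const
      · exact ((m2.pow_const 2).div m1).ennreal_ofReal
    have hpt : ∀ x ∈ 𝒳, ENNReal.ofReal (∑ j, x j * x j) ≤
        ENNReal.ofReal ((d + 2 * lam)⁻¹) * ∑ i, ∑ j, chiInt i j x := by
      intro x hx
      have hx' : ∀ i, 0 ≤ 1 + ∑ l, H i l * x l := hx
      set v : Fin d → ℝ := fun i => 1 + ∑ l, H i l * x l with hv
      have hsv : ∑ i, v i = d := by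
        simp only [hv, sum_add_distrib]
        rw [sum_comm]
        simp [← sum_mul, hcolsum]
      by_cases hpos : ∀ i, 0 < v i
      · have h := aux_pairs d hd v hpos hsv
        have e : ∀ i j, chiInt i j x = ENNReal.ofReal ((v j - v i) ^ 2 / v i) := by
          intro i j
          simp only [chiInt, hdiff]
          rw [if_neg (hpos i).ne']
        simp_rw [e]
        have e2 : ∑ i, ∑ j, ENNReal.ofReal ((v j - v i) ^ 2 / v i)
            = ENNReal.ofReal (∑ i, ∑ j, (v j - v i) ^ 2 / v i) := by
          have hnn : ∀ i j, 0 ≤ (v j - v i) ^ 2 / v i := fun i j => by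
            have := hpos i; positivity
          rw [ENNReal.ofReal_sum_of_nonneg fun i _ => sum_nonneg fun j _ => hnn i j]
          exact sum_congr rfl fun i _ => (ENNReal.ofReal_sum_of_nonneg fun j _ => hnn i j).symm
        rw [e2, ← ENNReal.ofReal_mul (by positivity)]
        apply ENNReal.ofReal_le_ofReal
        rw [inv_mul_eq_div, le_div_iff₀ (by positivity), ← aux_norm d H horth]
        simpa [hv] using h
      · push Not at hpos
        obtain ⟨i, hi⟩ := hpos
        have hi0 : v i = 0 := le_antisymm hi (hx' i)
        have : ∃ j, v j ≠ 0 := by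
          by_contra! hall
          rw [sum_eq_zero fun i _ => hall i] at hsv
          linarith
        obtain ⟨j, hj⟩ := this
        have htop : chiInt i j x = ⊤ := by
          simp only [chiInt, hdiff]
          have h1 : 1 + ∑ l, H i l * x l = 0 := hi0
          rw [if_pos h1, if_neg]
          rw [h1, sub_zero]; exact hj
        have : ∑ i, ∑ j, chiInt i j x = ⊤ := by
          rw [ENNReal.sum_eq_top]
          refine ⟨i, mem_univ _, ?_⟩
          rw [ENNReal.sum_eq_top]
          exact ⟨j, mem_univ _, htop⟩
        rw [this, ENNReal.mul_top]
        · exact le_top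
        · have : 0 < ((d : ℝ) + 2 * lam)⁻¹ := by positivity
          simpa using this
    have hae : ∀ᵐ x ∂ρ, x ∈ 𝒳 := hX
    have hchi : ∀ i j, ∫⁻ x, chiInt i j x ∂ρ ≤ if i = j then 0 else chi ρ := by
      intro i j
      split_ifs with h
      · subst h; simp [hself]
      · exact le_iSup_of_le i (le_iSup_of_le j (le_iSup_of_le h le_rfl))
    calc ENNReal.ofReal (trSig ρ)
        = ∑ j, ENNReal.ofReal (∫ x, x j * x j ∂ρ) := by
          simp only [trSig, Matrix.trace, Matrix.diag, Matrix.of_apply]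
          exact ENNReal.ofReal_sum_of_nonneg fun j _ =>
            integral_nonneg fun x => mul_self_nonneg _
      _ ≤ ∑ j, ∫⁻ x, ENNReal.ofReal (x j * x j) ∂ρ :=
          sum_le_sum fun j _ => aux_ofReal_integral_le ρ _ fun x => mul_self_nonneg _
      _ = ∫⁻ x, ENNReal.ofReal (∑ j, x j * x j) ∂ρ := by
          rw [← lintegral_finsetSum _ (fun j _ => by fun_prop)]
          exact lintegral_congr fun x =>
            (ENNReal.ofReal_sum_of_nonneg fun j _ => mul_self_nonneg _).symm
      _ ≤ ∫⁻ x, ENNReal.ofReal ((d + 2 * lam)⁻¹) * ∑ i, ∑ j, chiInt i j x ∂ρ :=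
          lintegral_mono_ae (hae.mono hpt)
      _ = ENNReal.ofReal ((d + 2 * lam)⁻¹) * ∑ i, ∑ j, ∫⁻ x, chiInt i j x ∂ρ := by
          rw [lintegral_const_mul _ (Finset.measurable_sum _ fun i _ =>
            Finset.measurable_sum _ fun j _ => hmeas i j),
            lintegral_finsetSum _ fun i _ => Finset.measurable_sum _ fun j _ => hmeas i j]
          congr 1
          exact sum_congr rfl fun i _ => lintegral_finsetSum _ fun j _ => hmeas i j
      _ ≤ ENNReal.ofReal ((d + 2 * lam)⁻¹) * ∑ i : Fin d, ∑ j : Fin d,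
            if i = j then 0 else chi ρ := by
          gcongr with i _ j _
          exact hchi i j
      _ = ENNReal.ofReal Kd * chi ρ := by
          have e1 : ∀ i : Fin d, ∑ j : Fin d, (if i = j then 0 else chi ρ)
              = ENNReal.ofReal (d - 1) * chi ρ := by
            intro i
            rw [← Finset.add_sum_erase univ _ (mem_univ i), if_pos rfl, zero_add,
              sum_congr rfl (g := fun _ => chi ρ)
                (fun j hj => if_neg (Finset.ne_of_mem_erase hj).symm), sum_const,
              card_erase_of_mem (mem_univ _), card_univ, Fintype.card_fin, nsmul_eq_mul]
            congr 1
            rw [← ENNReal.ofReal_natCast, Nat.cast_sub (by omega)]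
            simp
          simp_rw [e1]
          rw [sum_const, card_univ, Fintype.card_fin, nsmul_eq_mul, ← mul_assoc, ← mul_assoc,
            ← ENNReal.ofReal_natCast, ← ENNReal.ofReal_mul (by positivity),
            ← ENNReal.ofReal_mul (by positivity)]
          congr 2
          simp only [Kd]; ring
  · intro C hC0 hC p ρp
    have hden : 0 < (d : ℝ) + lam - 1 := by linarith
    have hCs : 0 < Cstar := by
      have : 0 < lam - 1 := by linarith
      simp only [Cstar]; positivity
    have hp0 : 0 ≤ p := div_nonneg hC0 hCs.le
    have hp1 : p ≤ 1 := (div_le_one hCs).2 hC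
    have hpC : p * Cstar = C := div_mul_cancel₀ _ hCs.ne'
    have hpd : 0 ≤ p / d := by positivity
    have hgram := aux_gram d hd H horth hcolsum
    have hdne : (d : ℝ) ≠ 0 := by linarith
    set b : ℝ := d / (d + lam - 1) with hb
    have hb0 : 0 < b := by positivity
    have ht : t = b * (lam - 1) := by simp only [t, hb]; ring
    have hdot : ∀ i k : Fin d, ∑ l, H i l * (t • fun j => H k j) l
        = t * ((if i = k then 1 else 0) - 1 / (d : ℝ)) := by
      intro i k
      rw [← hgram, mul_sum]
      exact sum_congr rfl fun l _ => by simp [Pi.smul_apply]; ring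
    have hval : ∀ i k : Fin d, 1 + ∑ l, H i l * (t • fun j => H k j) l
        = if i = k then lam * b else b := by
      intro i k
      rw [hdot]
      split_ifs
      · simp only [ht, hb]; field_simp; ring
      · simp only [ht, hb]; field_simp; ring
    have hint : ∀ {F : Type} [NormedAddCommGroup F] [NormedSpace ℝ F] [CompleteSpace F]
        (f : (Fin (d - 1) → ℝ) → F),
        ∫ x, f x ∂ρp = (1 - p) • f 0 + ∑ i, (p / d) • f (t • fun j => H i j) := by
      intro F _ _ _ f
      have hi : ∀ (c : ℝ) (a : Fin (d - 1) → ℝ),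
          Integrable f (ENNReal.ofReal c • Measure.dirac a) := fun c a =>
        (integrable_dirac (by simp)).smul_measure ENNReal.ofReal_ne_top
      simp only [ρp]
      rw [integral_add_measure (hi _ _) (integrable_finsetSum_measure.2 fun i _ => hi _ _),
        integral_finsetSum_measure fun i _ => hi _ _]
      simp only [integral_smul_measure, integral_dirac, ENNReal.toReal_ofReal hpd,
        ENNReal.toReal_ofReal (sub_nonneg.2 hp1)]
    have hlint : ∀ f : (Fin (d - 1) → ℝ) → ℝ≥0∞,
        ∫⁻ x, f x ∂ρp = ENNReal.ofReal (1 - p) * f 0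
          + ∑ i, ENNReal.ofReal (p / d) * f (t • fun j => H i j) := by
      intro f
      simp only [ρp, lintegral_add_measure, lintegral_finsetSum_measure, lintegral_smul_measure,
        lintegral_dirac, smul_eq_mul]
    have happ : ∀ s : Set (Fin (d - 1) → ℝ), ρp s = ENNReal.ofReal (1 - p) * s.indicator 1 0
          + ∑ i, ENNReal.ofReal (p / d) * s.indicator 1 (t • fun j => H i j) := by
      intro s
      simp only [ρp, Measure.add_apply, Measure.finsetSum_apply, Measure.smul_apply,
        Measure.dirac_apply, smul_eq_mul]
    refine ⟨⟨?_⟩, ?_, ?_, ?_, ?_⟩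
    · rw [happ]
      simp only [Set.indicator_univ, Pi.one_apply, mul_one, sum_const, card_univ,
        Fintype.card_fin, nsmul_eq_mul]
      rw [← ENNReal.ofReal_natCast, ← ENNReal.ofReal_mul (by positivity),
        ← ENNReal.ofReal_add (by linarith) (by positivity), mul_div_cancel₀ _ hdne]
      simp
    · rw [happ, Set.indicator_of_notMem, mul_zero, zero_add]
      · refine sum_eq_zero fun k _ => ?_
        rw [Set.indicator_of_notMem, mul_zero]
        simp only [Set.mem_compl_iff, not_not]
        intro i
        rw [hval]
        split_ifs <;> positivity
      · simp [𝒳]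
    · rw [hint]
      rw [smul_zero, zero_add]
      ext j
      simp only [Finset.sum_apply, Pi.smul_apply, smul_eq_mul, ← mul_sum, hcolsum]
      simp
    · have hval2 : ∀ i j : Fin d, i ≠ j → ∫⁻ x, chiInt i j x ∂ρp = ENNReal.ofReal C := by
        intro i j hij
        rw [hlint]
        have h0 : chiInt i j 0 = 0 := by simp [chiInt]
        have hk : ∀ k : Fin d, chiInt i j (t • fun l => H k l) = ENNReal.ofReal
            ((if k = i then t ^ 2 / (lam * b) else 0) + if k = j then t ^ 2 / b else 0) := by
          intro k
          simp only [chiInt, hdiff, hval]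
          rw [if_neg (by split_ifs <;> positivity)]
          congr 1
          rcases eq_or_ne k i with h | h
          · subst h
            simp [hij, hij.symm, ht]
            ring
          · rcases eq_or_ne k j with h' | h'
            · subst h'
              simp [hij, hij.symm, ht]
              ring
            · simp [h, h', h.symm, h'.symm]
        simp_rw [h0, hk]
        rw [mul_zero, zero_add, ← mul_sum, ← ENNReal.ofReal_sum_of_nonneg,
          ← ENNReal.ofReal_mul hpd]
        · congr 1
          rw [sum_add_distrib]
          simp only [Finset.sum_ite_eq', mem_univ, if_true]
          rw [← hpC]
          simp only [Cstar, ht, hb]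
          field_simp
          ring
        · intro k _
          split_ifs <;> positivity
      apply le_antisymm
      · exact iSup_le fun i => iSup_le fun j => iSup_le fun hij => (hval2 i j hij).le
      · have hij : (⟨0, by omega⟩ : Fin d) ≠ ⟨1, by omega⟩ := by simp
        exact le_iSup_of_le _ (le_iSup_of_le _ (le_iSup_of_le hij (hval2 _ _ hij).ge))
    · simp only [trSig, Matrix.trace, Matrix.diag, Matrix.of_apply]
      have e : ∀ j : Fin (d - 1), ∫ x, x j * x j ∂ρp
          = (p / d * t ^ 2) * ∑ i, H i j * H i j := by
        intro j
        rw [hint, mul_sum]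
        simp only [Pi.zero_apply, mul_zero, smul_zero, zero_add, Pi.smul_apply, smul_eq_mul]
        exact sum_congr rfl fun i _ => by ring
      simp_rw [e]
      rw [← mul_sum, sum_comm]
      simp_rw [hgram]
      simp only [if_true, sum_const, card_univ, Fintype.card_fin, nsmul_eq_mul]
      rw [← hpC]
      have hdl : (d : ℝ) = lam ^ 2 + 1 := by linarith
      have h2 : 0 < (d : ℝ) + 2 * lam := by positivity
      simp only [Cstar, Kd, ht, hb]
      field_simp
      rw [hdl]
      ring
end
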